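/- arXiv:2510.17103 — 2 statements merged into one kernel-verified Lean document; each statement's English description precedes it below -/
import Mathlib

section
/- Fix a layered episodic MDP with transition function P and a function ℓ* : S × A → [0,1] with ℓ*(s_L, a) = 0 for all a; define the Bellman-optimal functions Q*, V*, the gap function Δ(s,a) = Q*(s,a) − V*(s), the set 𝒬 of occupancy measures of all policies, and 𝒬* = { q ∈ 𝒬 : ⟨Δ, q⟩ = 0 }. Suppose s ∈ S ∖ {s_L} is such that q(s) > 0 for some q ∈ 𝒬*, and let q̄ = sup_{q ∈ 𝒬*} q(s). Then there exists a real number c > 0 such that for every q ∈ 𝒬: ⟨Δ, q⟩ ≥ c·max{0, q(s) − q̄} + Σ_{a ∈ A} Δ(s,a)·q(s,a). -/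
open MeasureTheory Finset

/-- A layered episodic MDP: finite state set `S` partitioned into layers `0, …, L` by `layer`,
with unique initial state `s0` (layer `0`), unique terminal state `sL` (layer `L`),
nonempty layers, and a transition function `P` supported on consecutive layers with rows
summing to `1` on non-terminal layers. -/
structure LayeredMDP (S A : Type) [Fintype S] [Fintype A] where
  L : ℕ
  layer : S → ℕ
  s0 : S
  sL : S
  P : S → A → S → ℝ
  layer_le : ∀ s, layer s ≤ L
  layer_s0 : layer s0 = 0
  layer_sL : layer sL = L
  s0_unique : ∀ s, layer s = 0 → s = s0
  sL_unique : ∀ s, layer s = L → s = sL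
  layer_nonempty : ∀ k, k ≤ L → ∃ s, layer s = k
  P_nonneg : ∀ s a s', 0 ≤ P s a s'
  P_layer : ∀ s a s', P s a s' ≠ 0 → layer s' = layer s + 1
  P_sum : ∀ s a, layer s < L → ∑ s', P s a s' = 1

variable {S A : Type} [Fintype S] [Fintype A] [DecidableEq S] [DecidableEq A]

/-- `pol` is a policy: nonnegative, and rows sum to `1` at every non-terminal state. -/
def IsPolicy (M : LayeredMDP S A) (pol : S → A → ℝ) : Prop :=
  (∀ s a, 0 ≤ pol s a) ∧ ∀ s, s ≠ M.sL → ∑ a, pol s a = 1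

/-- State-action value function computed with `n` remaining layers of fuel. -/
noncomputable def Qfuel (M : LayeredMDP S A) (pol l : S → A → ℝ) :
    ℕ → S → A → ℝ
  | 0, _, _ => 0
  | n + 1, s, a => l s a + ∑ s', M.P s a s' * ∑ a', pol s' a' * Qfuel M pol l n s' a'

/-- The state-action value function `Q^{P,π}(s,a; ℓ)`. -/
noncomputable def Qval (M : LayeredMDP S A) (pol l : S → A → ℝ) (s : S) (a : A) : ℝ :=
  if M.layer s = M.L then 0 else Qfuel M pol l (M.L - M.layer s) s a

/-- The state value function `V^{P,π}(s; ℓ) = ∑_a π(a|s) Q^{P,π}(s,a; ℓ)`. -/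
noncomputable def Vval (M : LayeredMDP S A) (pol l : S → A → ℝ) (s : S) : ℝ :=
  ∑ a, pol s a * Qval M pol l s a

/-- A trajectory `(s_0, a_0, …, s_{L-1}, a_{L-1}, s_L)`. -/
abbrev Traj (M : LayeredMDP S A) : Type := (Fin (M.L + 1) → S) × (Fin M.L → A)

/-- Probability of a given trajectory under policy `pol`. -/
noncomputable def trajProb (M : LayeredMDP S A) (pol : S → A → ℝ) (τ : Traj M) : ℝ :=
  (if τ.1 0 = M.s0 then (1 : ℝ) else 0) *
    ∏ k : Fin M.L, pol (τ.1 k.castSucc) (τ.2 k) * M.P (τ.1 k.castSucc) (τ.2 k) (τ.1 k.succ)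

/-- Indicator `𝕀(s)` that the trajectory visits state `s` at its layer. -/
noncomputable def stInd (M : LayeredMDP S A) (τ : Traj M) (s : S) : ℝ :=
  if τ.1 ⟨M.layer s, Nat.lt_succ_of_le (M.layer_le s)⟩ = s then 1 else 0

/-- Indicator `𝕀(s,a)` that the trajectory visits `(s,a)` at the layer of `s`. -/
noncomputable def saInd (M : LayeredMDP S A) (τ : Traj M) (s : S) (a : A) : ℝ :=
  if h : M.layer s < M.L then
    if τ.1 ⟨M.layer s, Nat.lt_succ_of_le (M.layer_le s)⟩ = s ∧ τ.2 ⟨M.layer s, h⟩ = a then 1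
    else 0
  else 0

/-- Occupancy measure `q^{P,π}(s,a) = Pr[(s_k, a_k) = (s,a)]`. -/
noncomputable def occSA (M : LayeredMDP S A) (pol : S → A → ℝ) (s : S) (a : A) : ℝ :=
  ∑ τ : Traj M, trajProb M pol τ * saInd M τ s a

/-- Occupancy measure `q^{P,π}(s) = Pr[s_k = s]`. -/
noncomputable def occS (M : LayeredMDP S A) (pol : S → A → ℝ) (s : S) : ℝ :=
  ∑ τ : Traj M, trajProb M pol τ * stInd M τ s

/-- Aggregate loss `∑_{k=0}^{L-1} ℓ(s_k, a_k)` of a trajectory. -/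
noncomputable def aggLoss (M : LayeredMDP S A) (l : S → A → ℝ) (τ : Traj M) : ℝ :=
  ∑ k : Fin M.L, l (τ.1 k.castSucc) (τ.2 k)

/-- Bellman-optimal state-action values with `n` layers of fuel. -/
noncomputable def QstarFuel (M : LayeredMDP S A) [Nonempty A] (l : S → A → ℝ) :
    ℕ → S → A → ℝ
  | 0, _, _ => 0
  | n + 1, s, a =>
      l s a + ∑ s', M.P s a s'
        * (Finset.univ.inf' Finset.univ_nonempty fun a' => QstarFuel M l n s' a')

/-- The Bellman-optimal state-action value `Q*(s,a)`. -/
noncomputable def Qstar (M : LayeredMDP S A) [Nonempty A] (l : S → A → ℝ)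
    (s : S) (a : A) : ℝ :=
  if M.layer s = M.L then 0 else QstarFuel M l (M.L - M.layer s) s a

/-- The Bellman-optimal state value `V*(s) = min_{a'} Q*(s,a')`. -/
noncomputable def Vstar (M : LayeredMDP S A) [Nonempty A] (l : S → A → ℝ) (s : S) : ℝ :=
  Finset.univ.inf' Finset.univ_nonempty fun a => Qstar M l s a

/-- `⟨f, q⟩ = ∑_{s ≠ s_L} ∑_a f(s,a)·q(s,a)`. -/
noncomputable def mdpInner (M : LayeredMDP S A) (f q : S → A → ℝ) : ℝ :=
  ∑ s ∈ Finset.univ.filter (· ≠ M.sL), ∑ a, f s a * q s a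

/-- `𝒬`: the set of occupancy measures of all policies. -/
def OccSet (M : LayeredMDP S A) : Set (S → A → ℝ) :=
  {q | ∃ pol : S → A → ℝ, IsPolicy M pol ∧ q = fun s a => occSA M pol s a}

set_option linter.unusedSectionVars false

namespace LayeredMDP

variable (M : LayeredMDP S A)

/-- Backward induction over the layers. -/
theorem backward_induction {p : S → Prop}
    (h : ∀ y, (∀ y', M.layer y' = M.layer y + 1 → p y') → p y) (y : S) : p y := by
  induction hn : M.L - M.layer y using Nat.strong_induction_on generalizing y with
  | _ n ih =>
    refine h y fun y' hy' => ih (M.L - M.layer y') ?_ y' rfl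
    have := M.layer_le y'
    omega

theorem layer_lt {y : S} (hy : y ≠ M.sL) : M.layer y < M.L :=
  lt_of_le_of_ne (M.layer_le y) fun h => hy (M.sL_unique y h)

/-- Averages against a transition row only depend on the next layer. -/
theorem sum_P_mono (y : S) (a : A) {F G : S → ℝ}
    (h : ∀ y', M.layer y' = M.layer y + 1 → F y' ≤ G y') :
    ∑ y', M.P y a y' * F y' ≤ ∑ y', M.P y a y' * G y' := by
  refine Finset.sum_le_sum fun y' _ => ?_
  by_cases hP : M.P y a y' = 0
  · simp [hP]
  · exact mul_le_mul_of_nonneg_left (h y' (M.P_layer y a y' hP)) (M.P_nonneg y a y')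

theorem sum_P_congr (y : S) (a : A) {F G : S → ℝ}
    (h : ∀ y', M.layer y' = M.layer y + 1 → F y' = G y') :
    ∑ y', M.P y a y' * F y' = ∑ y', M.P y a y' * G y' :=
  le_antisymm (M.sum_P_mono y a fun y' hy' => (h y' hy').le)
    (M.sum_P_mono y a fun y' hy' => (h y' hy').ge)

end LayeredMDP

/-- Sum of `H` over all paths with `n` steps started at `x`, weighted by the products of the step
weights `w`. -/
noncomputable def pathSum (w : S → A → S → ℝ) (n : ℕ) (x : S)
    (H : (Fin (n + 1) → S) → (Fin n → A) → ℝ) : ℝ :=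
  ∑ σ : Fin (n + 1) → S, ∑ α : Fin n → A,
    (if σ 0 = x then (1 : ℝ) else 0) *
      (∏ k : Fin n, w (σ k.castSucc) (α k) (σ k.succ)) * H σ α

theorem sum_fin_cons {n : ℕ} {B : Type} [Fintype B] (F : (Fin (n + 1) → B) → ℝ) :
    ∑ σ, F σ = ∑ b, ∑ σ' : Fin n → B, F (Fin.cons b σ') := by
  rw [← (Fin.consEquiv fun _ : Fin (n + 1) => B).sum_comp, Fintype.sum_prod_type]
  rfl

theorem pathSum_zero (w : S → A → S → ℝ) (x : S)
    (H : (Fin 1 → S) → (Fin 0 → A) → ℝ) :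
    pathSum w 0 x H = H (fun _ => x) Fin.elim0 := by
  unfold pathSum
  rw [Finset.sum_eq_single (fun _ => x)]
  · simp [Subsingleton.elim (default : Fin 0 → A) Fin.elim0]
  · intro σ _ hσ
    have : σ 0 ≠ x := fun h => hσ (by ext i; rw [Fin.fin_one_eq_zero i, h])
    simp [this]
  · simp

theorem pathSum_succ (w : S → A → S → ℝ) (n : ℕ) (x : S)
    (H : (Fin (n + 2) → S) → (Fin (n + 1) → A) → ℝ) :
    pathSum w (n + 1) x H =
      ∑ a, ∑ y, w x a y * pathSum w n y fun σ α => H (Fin.cons x σ) (Fin.cons a α) := by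
  have hR : ∀ a, ∑ y, w x a y *
      pathSum w n y (fun σ α => H (Fin.cons x σ) (Fin.cons a α)) =
      ∑ σ : Fin (n + 1) → S, ∑ α : Fin n → A, w x a (σ 0) *
        (∏ k : Fin n, w (σ k.castSucc) (α k) (σ k.succ)) *
          H (Fin.cons x σ) (Fin.cons a α) := by
    intro a
    simp only [pathSum, Finset.mul_sum]
    rw [Finset.sum_comm]
    refine Finset.sum_congr rfl fun σ _ => ?_
    rw [Finset.sum_comm]
    refine Finset.sum_congr rfl fun α _ => ?_
    rw [Finset.sum_eq_single (σ 0)]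
    · simp [mul_assoc]
    · intro y _ hy
      simp [hy.symm]
    · simp
  simp only [hR]
  unfold pathSum
  rw [sum_fin_cons, Finset.sum_eq_single x]
  · refine (Finset.sum_congr rfl fun σ _ => sum_fin_cons _).trans ?_
    rw [Finset.sum_comm]
    refine Finset.sum_congr rfl fun a _ => Finset.sum_congr rfl fun σ _ =>
      Finset.sum_congr rfl fun α _ => ?_
    simp only [Fin.prod_univ_succ, Fin.cons_zero, Fin.castSucc_zero, Fin.cons_succ,
      ← Fin.succ_castSucc, if_true, one_mul]
  · intro b _ hb
    simp [hb]
  · simp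

/-- The path weights of a policy started at `x` sum to `1`. -/
theorem pathSum_one (M : LayeredMDP S A) {pol : S → A → ℝ} (hpol : IsPolicy M pol) (n : ℕ)
    (x : S) (hx : M.layer x + n = M.L) :
    pathSum (fun x a y => pol x a * M.P x a y) n x (fun _ _ => 1) = 1 := by
  induction n generalizing x with
  | zero => rw [pathSum_zero]
  | succ n ih =>
    rw [pathSum_succ]
    have hlt : M.layer x < M.L := by omega
    have hne : x ≠ M.sL := by rintro rfl; rw [M.layer_sL] at hlt; omega
    have : ∀ a, ∑ y, pol x a * M.P x a y *
        pathSum (fun x a y => pol x a * M.P x a y) n y (fun _ _ => 1) = pol x a := by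
      intro a
      simp only [mul_assoc]
      rw [← Finset.mul_sum, M.sum_P_congr x a (G := fun _ => 1)]
      · simp [M.P_sum x a hlt]
      · intro y hy
        exact ih y (by omega)
    simp only [this, hpol.2 x hne]

/-- Expected total reward of a policy is bounded by any supersolution of the Bellman
recursion. -/
theorem pathSum_total_le (M : LayeredMDP S A) {pol : S → A → ℝ} (hpol : IsPolicy M pol)
    (f : S → A → ℝ) (G : S → ℝ) (hL : 0 ≤ G M.sL)
    (hG : ∀ y ≠ M.sL, ∑ a, pol y a * (f y a + ∑ y', M.P y a y' * G y') ≤ G y) (n : ℕ)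
    (x : S) (hx : M.layer x + n = M.L) :
    pathSum (fun x a y => pol x a * M.P x a y) n x
      (fun σ α => ∑ k : Fin n, f (σ k.castSucc) (α k)) ≤ G x := by
  induction n generalizing x with
  | zero =>
    rw [pathSum_zero, M.sL_unique x hx]
    simpa using hL
  | succ n ih =>
    have hlt : M.layer x < M.L := by omega
    have hne : x ≠ M.sL := by rintro rfl; rw [M.layer_sL] at hlt; omega
    refine le_trans ?_ (hG x hne)
    rw [pathSum_succ]
    refine Finset.sum_le_sum fun a _ => ?_
    simp only [mul_assoc]
    rw [← Finset.mul_sum]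
    refine mul_le_mul_of_nonneg_left ?_ (hpol.1 x a)
    calc _ ≤ ∑ y, M.P x a y * (f x a + G y) := by
          refine M.sum_P_mono x a fun y hy => ?_
          have hyn : M.layer y + n = M.L := by omega
          have h1 := pathSum_one M hpol n y hyn
          have h2 := ih y hyn
          refine le_trans (le_of_eq ?_) (add_le_add (le_of_eq (mul_one (f x a))) h2)
          rw [← h1]
          simp only [pathSum, Finset.mul_sum, ← Finset.sum_add_distrib]
          refine Finset.sum_congr rfl fun σ _ => Finset.sum_congr rfl fun α _ => ?_
          rw [Fin.sum_univ_succ]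
          simp only [Fin.cons_zero, Fin.castSucc_zero, Fin.cons_succ, ← Fin.succ_castSucc]
          ring
      _ = f x a + ∑ y, M.P x a y * G y := by
          simp only [mul_add, Finset.sum_add_distrib]
          rw [← Finset.sum_mul, M.P_sum x a hlt, one_mul]

theorem trajProb_nonneg (M : LayeredMDP S A) {pol : S → A → ℝ} (hpol : IsPolicy M pol)
    (τ : Traj M) : 0 ≤ trajProb M pol τ := by
  refine mul_nonneg (by split_ifs <;> simp) (Finset.prod_nonneg fun k _ => ?_)
  exact mul_nonneg (hpol.1 _ _) (M.P_nonneg _ _ _)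

theorem occSA_nonneg (M : LayeredMDP S A) {pol : S → A → ℝ} (hpol : IsPolicy M pol)
    (y : S) (a : A) : 0 ≤ occSA M pol y a := by
  refine Finset.sum_nonneg fun τ _ => mul_nonneg (trajProb_nonneg M hpol τ) ?_
  unfold saInd
  split_ifs <;> simp

theorem layer_of_trajProb_ne_zero (M : LayeredMDP S A) {pol : S → A → ℝ} {τ : Traj M}
    (h : trajProb M pol τ ≠ 0) (k : Fin (M.L + 1)) : M.layer (τ.1 k) = k := by
  have h0 : τ.1 0 = M.s0 := by
    by_contra h0
    exact h (by simp [trajProb, h0])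
  have hk := Finset.prod_ne_zero_iff.1 (right_ne_zero_of_mul h)
  induction k using Fin.induction with
  | zero => simp [h0, M.layer_s0]
  | succ k ih =>
    rw [M.P_layer _ _ _ (right_ne_zero_of_mul (hk k (mem_univ k))), ih]
    simp

theorem sum_mul_saInd (M : LayeredMDP S A) (f : S → A → ℝ) {τ : Traj M}
    (hτ : ∀ k, M.layer (τ.1 k) = k) :
    ∑ y ∈ Finset.univ.filter (· ≠ M.sL), ∑ a, f y a * saInd M τ y a = aggLoss M f τ := by
  have hind : ∀ y a, saInd M τ y a =
      ∑ k : Fin M.L, if τ.1 k.castSucc = y ∧ τ.2 k = a then (1 : ℝ) else 0 := by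
    intro y a
    unfold saInd
    split_ifs with h h'
    · rw [Finset.sum_eq_single ⟨M.layer y, h⟩]
      · exact (if_pos h').symm
      · intro k _ hk
        refine if_neg fun hy => hk (Fin.ext ?_)
        simpa [hy.1] using (hτ k.castSucc).symm
      · simp
    · refine (Finset.sum_eq_zero fun k _ => if_neg fun hy => h' ?_).symm
      have hk : (⟨M.layer y, h⟩ : Fin M.L) = k := by
        refine Fin.ext ?_
        simpa [hy.1] using hτ k.castSucc
      subst hk
      exact hy
    · refine (Finset.sum_eq_zero fun k _ => if_neg fun hy => h ?_).symm
      rw [← hy.1, hτ]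
      exact k.2
  simp only [hind, Finset.mul_sum]
  unfold aggLoss
  rw [Finset.sum_congr rfl fun y _ => Finset.sum_comm, Finset.sum_comm]
  refine Finset.sum_congr rfl fun k _ => ?_
  have hk : τ.1 k.castSucc ≠ M.sL := by
    intro h
    have := hτ k.castSucc
    rw [h, M.layer_sL, Fin.val_castSucc] at this
    exact absurd k.2 (by omega)
  rw [Finset.sum_eq_single (τ.1 k.castSucc), Finset.sum_eq_single (τ.2 k)]
  · simp
  · intro a _ ha
    simp [ha.symm]
  · simp
  · intro y _ hy
    simp [hy.symm]
  · simp [hk]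

theorem mdpInner_occSA (M : LayeredMDP S A) (pol f : S → A → ℝ) :
    mdpInner M f (fun y a => occSA M pol y a) =
      pathSum (fun x a y => pol x a * M.P x a y) M.L M.s0
        (fun σ α => ∑ k : Fin M.L, f (σ k.castSucc) (α k)) := by
  have h1 : mdpInner M f (fun y a => occSA M pol y a) =
      ∑ τ : Traj M, trajProb M pol τ * aggLoss M f τ := by
    simp only [mdpInner, occSA, Finset.mul_sum]
    rw [Finset.sum_congr rfl fun y _ => Finset.sum_comm, Finset.sum_comm]
    refine Finset.sum_congr rfl fun τ _ => ?_
    by_cases hτ : trajProb M pol τ = 0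
    · simp [hτ]
    · rw [← sum_mul_saInd M f (layer_of_trajProb_ne_zero M hτ)]
      simp only [Finset.mul_sum]
      refine Finset.sum_congr rfl fun y _ => Finset.sum_congr rfl fun a _ => ?_
      ring
  rw [h1, Fintype.sum_prod_type]
  rfl

/-- A supersolution of the Bellman recursion bounds the expected total reward of a policy. -/
theorem mdpInner_occSA_le (M : LayeredMDP S A) {pol : S → A → ℝ} (hpol : IsPolicy M pol)
    (f : S → A → ℝ) (G : S → ℝ) (hL : 0 ≤ G M.sL)
    (hG : ∀ y ≠ M.sL, ∑ a, pol y a * (f y a + ∑ y', M.P y a y' * G y') ≤ G y) :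
    mdpInner M f (fun y a => occSA M pol y a) ≤ G M.s0 := by
  rw [mdpInner_occSA]
  exact pathSum_total_le M hpol f G hL hG M.L M.s0 (by simp [M.layer_s0])

/-- An exact solution of the Bellman recursion is the expected total reward of a policy. -/
theorem mdpInner_occSA_eq (M : LayeredMDP S A) {pol : S → A → ℝ} (hpol : IsPolicy M pol)
    (f : S → A → ℝ) (G : S → ℝ) (hL : G M.sL = 0)
    (hG : ∀ y ≠ M.sL, ∑ a, pol y a * (f y a + ∑ y', M.P y a y' * G y') = G y) :
    mdpInner M f (fun y a => occSA M pol y a) = G M.s0 := by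
  refine le_antisymm (mdpInner_occSA_le M hpol f G hL.ge fun y hy => (hG y hy).le) ?_
  have h := mdpInner_occSA_le M hpol (fun y a => -f y a) (fun y => -G y) (by simp [hL])
    fun y hy => by
      rw [← hG y hy, ← Finset.sum_neg_distrib]
      refine (Finset.sum_congr rfl fun a _ => ?_).le
      simp only [mul_neg, Finset.sum_neg_distrib]
      ring
  simp only [mdpInner, neg_mul, Finset.sum_neg_distrib] at h
  exact neg_le_neg_iff.1 h

/-- Largest expected number of visits to `s` within `n` steps when only actions with `D = 0` are
allowed. -/
noncomputable def reachFuel (M : LayeredMDP S A) (D : S → A → ℝ) (s : S) : ℕ → S → ℝ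
  | 0, _ => 0
  | n + 1, y => (if y = s then 1 else 0) +
      ⨆ a : {a // D y a = 0}, ∑ y', M.P y a y' * reachFuel M D s n y'

theorem exists_reach (M : LayeredMDP S A) {D : S → A → ℝ} (hD : ∀ y, ∃ a, D y a = 0) (s : S) :
    ∃ (W : S → ℝ) (g : S → A), W M.sL = 0 ∧ (∀ y, D y (g y) = 0) ∧
      (∀ y ≠ M.sL, (if y = s then 1 else 0) + ∑ y', M.P y (g y) y' * W y' = W y) ∧
      ∀ y ≠ M.sL, ∀ a, D y a = 0 →
        (if y = s then 1 else 0) + ∑ y', M.P y a y' * W y' ≤ W y := by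
  set W : S → ℝ := fun y => reachFuel M D s (M.L - M.layer y) y with hW
  have hne : ∀ y, Nonempty {a // D y a = 0} := fun y => let ⟨a, ha⟩ := hD y; ⟨⟨a, ha⟩⟩
  have hrec : ∀ y ≠ M.sL, W y = (if y = s then 1 else 0) +
      ⨆ a : {a // D y a = 0}, ∑ y', M.P y a y' * W y' := by
    intro y hy
    have hlt := M.layer_lt hy
    obtain ⟨n, hn⟩ : ∃ n, M.L - M.layer y = n + 1 := ⟨M.L - M.layer y - 1, by omega⟩
    simp only [hW]
    rw [hn, reachFuel]
    congr 1
    refine iSup_congr fun a => M.sum_P_congr y a fun y' hy' => ?_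
    rw [show M.L - M.layer y' = n by omega]
  have hatt : ∀ y, ∃ a : {a // D y a = 0}, ∑ y', M.P y a y' * W y' =
      ⨆ a : {a // D y a = 0}, ∑ y', M.P y a y' * W y' := fun y =>
    have := hne y
    exists_eq_ciSup_of_finite
  choose g hg using hatt
  refine ⟨W, fun y => g y, ?_, fun y => (g y).2, fun y hy => ?_, fun y hy a ha => ?_⟩
  · simp [hW, M.layer_sL, reachFuel]
  · rw [hrec y hy, hg]
  · rw [hrec y hy]
    gcongr
    exact le_ciSup (f := fun a : {a // D y a = 0} => ∑ y', M.P y a y' * W y')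
      (Set.finite_range _).bddAbove ⟨a, ha⟩

theorem exists_pos_le_of_pos {ι : Type*} [Finite ι] (f : ι → ℝ) :
    ∃ c : ℝ, 0 < c ∧ ∀ i, 0 < f i → c ≤ f i := by
  classical
  have := Fintype.ofFinite ι
  rcases (Finset.univ.filter fun i => 0 < f i).eq_empty_or_nonempty with h | h
  · refine ⟨1, one_pos, fun i hi => ?_⟩
    have : i ∈ Finset.univ.filter fun i => 0 < f i := by simp [hi]
    simp [h] at this
  · obtain ⟨i, hi, hmin⟩ := Finset.exists_min_image _ f h
    exact ⟨f i, (Finset.mem_filter.1 hi).2, fun j hj => hmin j (by simp [hj])⟩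

theorem mdpInner_indicator (M : LayeredMDP S A) {s : S} (hs : s ≠ M.sL) (q : S → A → ℝ) :
    mdpInner M (fun y _ => if y = s then 1 else 0) q = ∑ a, q s a := by
  unfold mdpInner
  rw [Finset.sum_eq_single s]
  · simp
  · intro y _ hy
    simp [hy]
  · simp [hs]

theorem mdpInner_sub_row (M : LayeredMDP S A) {s : S} (hs : s ≠ M.sL) (D q : S → A → ℝ) :
    mdpInner M D q - ∑ a, D s a * q s a =
      mdpInner M (fun y a => if y = s then 0 else D y a) q := by
  unfold mdpInner
  have hmem : s ∈ Finset.univ.filter (· ≠ M.sL) := by simp [hs]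
  rw [← Finset.add_sum_erase _ _ hmem, ← Finset.add_sum_erase _ _ hmem]
  simp only [if_true, zero_mul, Finset.sum_const_zero, zero_add, add_sub_cancel_left]
  refine Finset.sum_congr rfl fun y hy => ?_
  simp [(Finset.mem_erase.1 hy).1]

/-- For a nonnegative cost `D` with a free action at every state, exceeding the best free
probability of visiting `s` costs proportionally outside `s`. -/
theorem exists_cost_bound (M : LayeredMDP S A) {D : S → A → ℝ} (hD0 : ∀ y a, 0 ≤ D y a)
    (hD : ∀ y, ∃ a, D y a = 0) {s : S} (hs : s ≠ M.sL) :
    ∃ c : ℝ, 0 < c ∧ ∃ q₀ ∈ OccSet M, mdpInner M D q₀ = 0 ∧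
      ∀ q ∈ OccSet M, c * (∑ a, q s a - ∑ a, q₀ s a) ≤
        mdpInner M D q - ∑ a, D s a * q s a := by
  obtain ⟨W, g, hWL, hg, hWg, hWle⟩ := exists_reach M hD s
  obtain ⟨c, hc, hcD⟩ := exists_pos_le_of_pos fun p : S × A => D p.1 p.2
  have hW0 : ∀ y, 0 ≤ W y := by
    refine M.backward_induction fun y ih => ?_
    by_cases hy : y = M.sL
    · rw [hy, hWL]
    · rw [← hWg y hy]
      have h := M.sum_P_mono y (g y) (F := fun _ => 0) ih
      simp only [mul_zero, Finset.sum_const_zero] at h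
      split_ifs <;> linarith
  have hW1 : ∀ y, W y ≤ if M.layer y ≤ M.layer s then 1 else 0 := by
    refine M.backward_induction fun y ih => ?_
    by_cases hy : y = M.sL
    · rw [hy, hWL]
      split_ifs <;> simp
    · rw [← hWg y hy]
      have hlt := M.layer_lt hy
      by_cases hys : M.layer y < M.layer s
      · have hne : y ≠ s := by rintro rfl; exact lt_irrefl _ hys
        have h := M.sum_P_mono y (g y) (G := fun _ => 1) fun y' hy' =>
          (ih y' hy').trans (by split_ifs <;> simp)
        simp only [mul_one, M.P_sum y (g y) hlt] at h
        simpa [hne, hys.le] using h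
      · have h := M.sum_P_mono y (g y) (G := fun _ => 0) fun y' hy' =>
          (ih y' hy').trans (by rw [if_neg]; omega)
        simp only [mul_zero, Finset.sum_const_zero] at h
        by_cases hne : y = s
        · simpa [hne] using h
        · simp only [hne, if_false, zero_add]
          exact h.trans (by split_ifs <;> simp)
  set pol₀ : S → A → ℝ := fun y a => if a = g y then 1 else 0 with hpol₀_def
  have hpol₀ : IsPolicy M pol₀ :=
    ⟨fun y a => by simp only [hpol₀_def]; split_ifs <;> simp, fun y _ => by simp [hpol₀_def]⟩
  refine ⟨c, hc, _, ⟨pol₀, hpol₀, rfl⟩, ?_, ?_⟩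
  · exact mdpInner_occSA_eq M hpol₀ D (fun _ => 0) rfl fun y _ => by simp [hpol₀_def, hg]
  · rintro q ⟨pol, hpol, rfl⟩
    have hq₀ : ∑ a, occSA M pol₀ s a = W M.s0 := by
      rw [← mdpInner_indicator M hs (fun y a => occSA M pol₀ y a)]
      exact mdpInner_occSA_eq M hpol₀ _ W hWL fun y hy => by simp [hpol₀_def, hWg y hy]
    have hle := mdpInner_occSA_le M hpol
      (fun y a => (if y = s then 1 else 0) - (if y = s then 0 else D y a) / c) W hWL.ge
      fun y hy => by
        calc _ ≤ ∑ a, pol y a * W y := by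
              refine Finset.sum_le_sum fun a _ =>
                mul_le_mul_of_nonneg_left ?_ (hpol.1 y a)
              by_cases hys : y = s
              · subst hys
                have h1 := M.sum_P_mono y a (G := fun _ => 0) fun y' hy' =>
                  (hW1 y').trans (by rw [if_neg]; omega)
                have h2 := M.sum_P_mono y (g y) (F := fun _ => 0) fun y' _ => hW0 y'
                have h3 := hWg y hy
                simp only [mul_zero, Finset.sum_const_zero, if_true] at h1 h2 h3
                simp only [if_true, zero_div]
                linarith
              · simp only [hys, if_false]
                rcases (hD0 y a).eq_or_lt with h0 | h0
                · have h := hWle y hy a h0.symm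
                  simpa [hys, ← h0] using h
                · have h1 := M.sum_P_mono y a (G := fun _ => 1) fun y' _ =>
                    (hW1 y').trans (by split_ifs <;> simp)
                  simp only [mul_one, M.P_sum y a (M.layer_lt hy)] at h1
                  have h2 : 1 ≤ D y a / c := (one_le_div hc).2 (hcD (y, a) h0)
                  linarith [hW0 y]
          _ = W y := by rw [← Finset.sum_mul, hpol.2 y hy, one_mul]
    have hsplit : mdpInner M
        (fun y a => (if y = s then 1 else 0) - (if y = s then 0 else D y a) / c)
        (fun y a => occSA M pol y a) = ∑ a, occSA M pol s a -
          (mdpInner M D (fun y a => occSA M pol y a) - ∑ a, D s a * occSA M pol s a) / c := by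
      rw [mdpInner_sub_row M hs D (fun y a => occSA M pol y a),
        ← mdpInner_indicator M hs (fun y a => occSA M pol y a)]
      simp only [mdpInner, sub_mul, Finset.sum_sub_distrib, div_mul_eq_mul_div,
        ← Finset.sum_div]
    rw [hsplit, ← hq₀] at hle
    rw [← le_div_iff₀' hc]
    linarith

/-- Lemma on the local gap constant.
With `Δ(s,a) = Q*(s,a) − V*(s)`, `𝒬* = {q ∈ 𝒬 : ⟨Δ, q⟩ = 0}`, a state `s ≠ s_L` with
`q(s) > 0` for some `q ∈ 𝒬*`, and `q̄ = sup_{q ∈ 𝒬*} q(s)`, there exists `c > 0` such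
that every `q ∈ 𝒬` satisfies
`⟨Δ, q⟩ ≥ c·max{0, q(s) − q̄} + ∑_a Δ(s,a)·q(s,a)`. -/
theorem stmt18 [Nonempty A] (M : LayeredMDP S A) (lstar : S → A → ℝ)
    (hl : ∀ s a, lstar s a ∈ Set.Icc (0 : ℝ) 1)
    (hlL : ∀ a, lstar M.sL a = 0)
    (s : S) (hs : s ≠ M.sL)
    (hpos : ∃ q ∈ OccSet M,
      mdpInner M (fun s' a => Qstar M lstar s' a - Vstar M lstar s') q = 0 ∧
        0 < ∑ a, q s a) :
    ∃ c : ℝ, 0 < c ∧ ∀ q ∈ OccSet M,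
      mdpInner M (fun s' a => Qstar M lstar s' a - Vstar M lstar s') q
        ≥ c * max 0 ((∑ a, q s a) -
            sSup ((fun q' : S → A → ℝ => ∑ a, q' s a) ''
              {q' ∈ OccSet M |
                mdpInner M (fun s' a => Qstar M lstar s' a - Vstar M lstar s') q' = 0}))
          + ∑ a, (Qstar M lstar s a - Vstar M lstar s) * q s a := by
  set D : S → A → ℝ := fun s' a => Qstar M lstar s' a - Vstar M lstar s' with hDdef
  have hD0 : ∀ y a, 0 ≤ D y a := fun y a =>
    sub_nonneg.2 (Finset.inf'_le _ (Finset.mem_univ a))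
  have hD : ∀ y, ∃ a, D y a = 0 := fun y => by
    obtain ⟨a, -, ha⟩ := Finset.exists_mem_eq_inf' Finset.univ_nonempty (Qstar M lstar y)
    exact ⟨a, sub_eq_zero.2 ha.symm⟩
  obtain ⟨c, hc, q₀, hq₀, hq₀D, hbound⟩ := exists_cost_bound M hD0 hD hs
  have hnn : ∀ q ∈ OccSet M, ∀ y a, 0 ≤ D y a * q y a := by
    rintro q ⟨pol, hpol, rfl⟩ y a
    exact mul_nonneg (hD0 y a) (occSA_nonneg M hpol y a)
  refine ⟨c, hc, fun q hq => ?_⟩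
  have hsup : ∑ a, q₀ s a ≤ sSup ((fun q' : S → A → ℝ => ∑ a, q' s a) ''
      {q' ∈ OccSet M | mdpInner M D q' = 0}) := by
    refine le_csSup ⟨∑ a, q₀ s a, ?_⟩ ⟨q₀, ⟨hq₀, hq₀D⟩, rfl⟩
    rintro _ ⟨q', ⟨hq', hq'D⟩, rfl⟩
    have h := hbound q' hq'
    have h' : 0 ≤ ∑ a, D s a * q' s a := Finset.sum_nonneg fun a _ => hnn q' hq' s a
    rw [hq'D] at h
    have := nonpos_of_mul_nonpos_right (h.trans (by linarith)) hc
    exact sub_nonpos.1 this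
  have hrest : 0 ≤ mdpInner M D q - ∑ a, D s a * q s a := by
    rw [mdpInner_sub_row M hs]
    refine Finset.sum_nonneg fun y _ => Finset.sum_nonneg fun a _ => ?_
    by_cases hy : y = s
    · simp [hy]
    · simpa [hy] using hnn q hq y a
  have hmain : c * max 0 ((∑ a, q s a) - sSup ((fun q' : S → A → ℝ => ∑ a, q' s a) ''
      {q' ∈ OccSet M | mdpInner M D q' = 0})) ≤ mdpInner M D q - ∑ a, D s a * q s a := by
    rw [mul_max_of_nonneg _ _ hc.le, mul_zero]
    refine max_le hrest (le_trans ?_ (hbound q hq))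
    exact mul_le_mul_of_nonneg_left (sub_le_sub_left hsup _) hc.le
  linarith
end

section
/- Let R, U, C, B be nonnegative real numbers. If R ≤ √(U·(R + C)) + B, then R ≤ U + 2·√(U·C) + 2·B. -/
/-- algebraic step of the self-bounding technique.
If `R, U, C, B ≥ 0` and `R ≤ √(U·(R + C)) + B`, then `R ≤ U + 2√(U·C) + 2B`. -/
theorem stmt19 (R U C B : ℝ) (hR : 0 ≤ R) (hU : 0 ≤ U) (hC : 0 ≤ C) (hB : 0 ≤ B)
    (h : R ≤ Real.sqrt (U * (R + C)) + B) :
    R ≤ U + 2 * Real.sqrt (U * C) + 2 * B := by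
  have key : Real.sqrt (U * (R + C)) ≤ (U + R) / 2 + Real.sqrt (U * C) := by
    have hs : Real.sqrt (U * C) ^ 2 = U * C := Real.sq_sqrt (mul_nonneg hU hC)
    have hs₀ : 0 ≤ Real.sqrt (U * C) := Real.sqrt_nonneg _
    refine Real.sqrt_le_iff.mpr ⟨by positivity, ?_⟩
    nlinarith [sq_nonneg (U - R), mul_nonneg (add_nonneg hU hR) hs₀]
  linarith
end
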